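/- arXiv:2507.09148 — 6 statements merged into one kernel-verified Lean document; each statement's English description precedes it below -/
import Mathlib

section
/- Let d be a positive integer, let k > 0 be a real number, and let W ∈ ℝ^{d×d} be a symmetric positive semidefinite matrix with tr(W) = 1, ∑_{i,j=1}^d |W_{ij}| ≤ k, and rank(W) = r. Then ∑_{i=1}^d √(W_{ii}) ≤ √(r·k). -/
open Matrix Finset

/-- The sum of the squared eigenvalues of a symmetric matrix is its squared Frobenius norm. -/
theorem Matrix.IsHermitian.sum_sq_eigenvalues {n : Type*} [Fintype n] [DecidableEq n]
    {A : Matrix n n ℝ} (hA : A.IsHermitian) :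
    ∑ i, hA.eigenvalues i ^ 2 = ∑ i, ∑ j, A i j ^ 2 := by
  have htrace : (A * A).trace = ∑ i, hA.eigenvalues i ^ 2 := by
    conv_lhs => rw [hA.spectral_theorem, ← map_mul, Unitary.conjStarAlgAut_apply,
      trace_mul_comm, ← mul_assoc, Unitary.coe_star_mul_self, one_mul, diagonal_mul_diagonal,
      trace_diagonal]
    simp [sq]
  rw [← htrace]
  simp only [trace, diag_apply, mul_apply]
  refine sum_congr rfl fun i _ => sum_congr rfl fun j _ => ?_
  have hij : A j i = A i j := by simpa using hA.apply i j
  rw [hij, sq]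

/-- The squared trace of a symmetric matrix is at most its rank times its squared
Frobenius norm. -/
theorem Matrix.IsHermitian.sq_trace_le_rank_mul_sum_sq {n : Type*} [Fintype n]
    {A : Matrix n n ℝ} (hA : A.IsHermitian) :
    A.trace ^ 2 ≤ A.rank * ∑ i, ∑ j, A i j ^ 2 := by
  classical
  have htr : A.trace = ∑ i with hA.eigenvalues i ≠ 0, hA.eigenvalues i := by
    rw [sum_filter_ne_zero, hA.trace_eq_sum_eigenvalues]
    simp
  rw [htr, hA.rank_eq_card_non_zero_eigs, Fintype.card_subtype, ← hA.sum_sq_eigenvalues]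
  refine sq_sum_le_card_mul_sum_sq.trans ?_
  gcongr
  exact filter_subset _ _

/-- Each entry of a positive semidefinite matrix is bounded by the geometric mean of the
corresponding diagonal entries. -/
theorem Matrix.PosSemidef.abs_apply_le_sqrt_mul_sqrt {n : Type*} {A : Matrix n n ℝ}
    (hA : A.PosSemidef) (i j : n) : |A i j| ≤ √(A i i) * √(A j j) := by
  rw [← Real.sqrt_mul hA.diag_nonneg]
  apply Real.abs_le_sqrt
  have hdet := (hA.submatrix ![i, j]).det_nonneg
  have hij : A j i = A i j := by simpa using hA.isHermitian.apply i j
  rw [det_fin_two] at hdet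
  simp only [submatrix_apply, cons_val_zero, cons_val_one, hij] at hdet
  linarith

/-- The squared sum of the square roots of the diagonal entries of a positive semidefinite
matrix is at most its rank times its entrywise 1-norm. -/
theorem Matrix.PosSemidef.sq_sum_sqrt_diag_le_rank_mul_sum_abs {n : Type*} [Fintype n]
    {W : Matrix n n ℝ} (hW : W.PosSemidef) :
    (∑ i, √(W i i)) ^ 2 ≤ W.rank * ∑ i, ∑ j, |W i j| := by
  classical
  set D : Matrix n n ℝ := diagonal fun i => (√√(W i i))⁻¹ with hD
  set M : Matrix n n ℝ := D * W * D with hM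
  have hMapply (i j : n) : M i j = (√√(W i i))⁻¹ * W i j * (√√(W j j))⁻¹ := by
    simp [hM, hD, diagonal_mul, mul_diagonal]
  have hMherm : M.IsHermitian := by
    have h := (hW.mul_mul_conjTranspose_same D).isHermitian
    rwa [show Dᴴ = D by simp [hD]] at h
  have htrace : M.trace = ∑ i, √(W i i) := by
    refine sum_congr rfl fun i _ => ?_
    rw [diag_apply, hMapply, mul_right_comm, ← mul_inv, Real.mul_self_sqrt (Real.sqrt_nonneg _),
      mul_comm, ← div_eq_mul_inv, Real.div_sqrt]
  have hentry (i j : n) : M i j ^ 2 ≤ |W i j| := by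
    have hle := hW.abs_apply_le_sqrt_mul_sqrt i j
    calc M i j ^ 2 = |W i j| * (|W i j| / (√(W i i) * √(W j j))) := by
          rw [hMapply, mul_pow, mul_pow, inv_pow, inv_pow, Real.sq_sqrt (Real.sqrt_nonneg _),
            Real.sq_sqrt (Real.sqrt_nonneg _), ← sq_abs (W i j), div_eq_mul_inv, mul_inv]
          ring
      _ ≤ |W i j| * 1 := by
          gcongr
          exact div_le_one_of_le₀ hle (by positivity)
      _ = |W i j| := mul_one _
  have hrank : M.rank ≤ W.rank := (rank_mul_le_left _ _).trans (rank_mul_le_right _ _)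
  rw [← htrace]
  refine hMherm.sq_trace_le_rank_mul_sum_sq.trans ?_
  gcongr
  exact hentry _ _

/-- Let `W` be a `d × d` symmetric positive semidefinite real matrix with
`tr(W) = 1`, entrywise 1-norm at most `k`, and rank `r`.
Then `∑ i, √(W i i) ≤ √(r·k)`. -/
theorem sum_sqrt_diag_le_sqrt_rank_mul
    (d : ℕ) (hd : 0 < d) (k : ℝ) (hk : 0 < k) (r : ℕ)
    (W : Matrix (Fin d) (Fin d) ℝ) (hW : W.PosSemidef) (htr : W.trace = 1)
    (h1 : ∑ i, ∑ j, |W i j| ≤ k) (hrank : W.rank = r) :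
    ∑ i, Real.sqrt (W i i) ≤ Real.sqrt ((r : ℝ) * k) := by
  apply Real.le_sqrt_of_sq_le
  refine hW.sq_sum_sqrt_diag_le_rank_mul_sum_abs.trans ?_
  rw [hrank]
  gcongr
end

section
/- Let S ∈ ℝ^{d×d} be a symmetric positive semidefinite matrix whose nullspace has dimension r ≥ 1, let n₁,…,n_r be an orthonormal basis of the nullspace of S, let N = (n₁,…,n_r) ∈ ℝ^{d×r} be the matrix with these columns, and for i ∈ {1,…,d} let N_i ∈ ℝ^r denote the i-th row of N. Let k > 0 and assume ∑_{i=1}^d ‖N_i‖₂ ≤ √(r·k). Then there exists a unit vector v ∈ ℝ^d with S·v = 0 and ‖v‖₁ ≤ √k. In particular, for every λ ≥ 0 such that A := λ·I_d − S is positive semidefinite, v is an eigenvector of A associated with its maximal eigenvalue λ and satisfies ‖v‖₁ ≤ √k. -/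
open Matrix Finset

/-- Distinct coordinates of a uniformly random sign vector are uncorrelated. -/
theorem sum_signs_mul {ι : Type*} [Fintype ι] [DecidableEq ι] (j l : ι) :
    ∑ ε : ι → ℤˣ, ((ε j : ℤ) : ℝ) * ((ε l : ℤ) : ℝ) =
      if j = l then (Fintype.card (ι → ℤˣ) : ℝ) else 0 := by
  split_ifs with h
  · subst h
    have hsq : ∀ u : ℤˣ, ((u : ℤ) : ℝ) * ((u : ℤ) : ℝ) = 1 := by
      intro u
      rcases Int.units_eq_one_or u with h | h <;> simp [h]
    simp only [hsq, Finset.sum_const, Finset.card_univ, nsmul_eq_mul, mul_one]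
  · have key := Equiv.sum_comp (Equiv.mulRight (Pi.mulSingle j (-1 : ℤˣ)))
      (fun ε : ι → ℤˣ => ((ε j : ℤ) : ℝ) * ((ε l : ℤ) : ℝ))
    simp only [Equiv.coe_mulRight, Pi.mul_apply, Pi.mulSingle_eq_same,
      Pi.mulSingle_eq_of_ne (Ne.symm h), mul_one, mul_neg, Units.val_neg, Int.cast_neg,
      neg_mul, Finset.sum_neg_distrib] at key
    linarith

/-- The second moment of a Rademacher sum. -/
theorem sum_signs_sq {ι : Type*} [Fintype ι] [DecidableEq ι] (a : ι → ℝ) :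
    ∑ ε : ι → ℤˣ, (∑ j, ((ε j : ℤ) : ℝ) * a j) ^ 2 =
      (Fintype.card (ι → ℤˣ) : ℝ) * ∑ j, a j ^ 2 := by
  have expand : ∀ ε : ι → ℤˣ, (∑ j, ((ε j : ℤ) : ℝ) * a j) ^ 2 =
      ∑ j, ∑ l, (((ε j : ℤ) : ℝ) * ((ε l : ℤ) : ℝ)) * (a j * a l) := by
    intro ε
    rw [sq, Finset.sum_mul_sum]
    exact Finset.sum_congr rfl fun j _ => Finset.sum_congr rfl fun l _ => by ring
  simp only [expand]
  rw [Finset.sum_comm, Finset.mul_sum]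
  refine Finset.sum_congr rfl fun j _ => ?_
  rw [Finset.sum_comm]
  simp only [← Finset.sum_mul, sum_signs_mul, ite_mul, zero_mul, Finset.sum_ite_eq,
    Finset.mem_univ, if_true]
  ring

/-- The upper Khintchine inequality for the first moment, with constant one. -/
theorem sum_signs_abs_le {ι : Type*} [Fintype ι] [DecidableEq ι] (a : ι → ℝ) :
    ∑ ε : ι → ℤˣ, |∑ j, ((ε j : ℤ) : ℝ) * a j| ≤
      (Fintype.card (ι → ℤˣ) : ℝ) * √(∑ j, a j ^ 2) := by
  have h := sq_sum_le_card_mul_sum_sq (s := Finset.univ)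
    (f := fun ε : ι → ℤˣ => |∑ j, ((ε j : ℤ) : ℝ) * a j|)
  simp only [sq_abs, sum_signs_sq, Finset.card_univ] at h
  refine (sq_le_sq₀ (by positivity) (by positivity)).mp ?_
  rw [mul_pow, Real.sq_sqrt (by positivity)]
  linarith

/-- Some sign vector `ε` satisfies `‖N ε‖₁ ≤ ∑ i, ‖N i‖₂`. -/
theorem exists_signs_sum_abs_le {κ ι : Type*} [Fintype κ] [Fintype ι] (N : Matrix κ ι ℝ) :
    ∃ ε : ι → ℤˣ, ∑ i, |∑ j, ((ε j : ℤ) : ℝ) * N i j| ≤ ∑ i, √(∑ j, N i j ^ 2) := by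
  classical
  obtain ⟨ε, -, hε⟩ := Finset.exists_le_of_sum_le
    (s := (Finset.univ : Finset (ι → ℤˣ))) Finset.univ_nonempty
    (f := fun ε => ∑ i, |∑ j, ((ε j : ℤ) : ℝ) * N i j|)
    (g := fun _ => ∑ i, √(∑ j, N i j ^ 2)) (by
      rw [Finset.sum_comm, Finset.sum_const, nsmul_eq_mul, Finset.card_univ, Finset.mul_sum]
      exact Finset.sum_le_sum fun i _ => sum_signs_abs_le (N i))
  exact ⟨ε, hε⟩

/-- Matrices with orthonormal columns preserve the sum of squares. -/
theorem sum_sq_eq_of_orthonormal_columns {κ ι : Type*} [Fintype κ] [Fintype ι] [DecidableEq ι]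
    (N : Matrix κ ι ℝ)
    (horth : ∀ j j' : ι, (∑ i, N i j * N i j') = if j = j' then (1 : ℝ) else 0) (c : ι → ℝ) :
    ∑ i, (N *ᵥ c) i ^ 2 = ∑ j, c j ^ 2 := by
  have hN : Nᵀ * N = 1 := by
    ext j l
    simp [Matrix.mul_apply, horth, Matrix.one_apply]
  have h : (N *ᵥ c) ⬝ᵥ (N *ᵥ c) = c ⬝ᵥ c := by
    rw [Matrix.dotProduct_mulVec, Matrix.vecMul_mulVec, hN, Matrix.vecMul_one]
  simpa [dotProduct, sq] using h

/-- Every eigenvalue of `lam • 1 - S` with `S` positive semidefinite is at most `lam`. -/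
theorem eigenvalue_smul_one_sub_le {κ : Type*} [Fintype κ] [DecidableEq κ]
    {S : Matrix κ κ ℝ} (hS : S.PosSemidef) {lam μ : ℝ}
    (hμ : Module.End.HasEigenvalue (Matrix.toLin' (lam • (1 : Matrix κ κ ℝ) - S)) μ) :
    μ ≤ lam := by
  obtain ⟨w, hw⟩ := hμ.exists_hasEigenvector
  have hAw := hw.apply_eq_smul
  rw [Matrix.toLin'_apply, Matrix.sub_mulVec, Matrix.smul_mulVec, Matrix.one_mulVec] at hAw
  have hdot := congrArg (fun x => w ⬝ᵥ x) hAw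
  simp only [dotProduct_sub, dotProduct_smul, smul_eq_mul] at hdot
  have hSw : 0 ≤ w ⬝ᵥ S *ᵥ w := by simpa using hS.dotProduct_mulVec_nonneg w
  have hpos : 0 < w ⬝ᵥ w := by simpa using Matrix.dotProduct_star_self_pos_iff.mpr hw.2
  refine le_of_mul_le_mul_right ?_ hpos
  linarith

/-- Let `S ⪰ 0` be a `d × d` real matrix whose nullspace has dimension
`r ≥ 1`, let the columns of `N ∈ ℝ^{d×r}` be an orthonormal basis of the nullspace of `S`,
and let `N i` denote the `i`-th row of `N`. If `∑ i, ‖N i‖₂ ≤ √(r·k)`, then there is a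
unit vector `v` with `S v = 0` and `‖v‖₁ ≤ √k`; in particular, for every `λ ≥ 0` such that
`A := λ I − S ⪰ 0`, `v` is an eigenvector of `A` for the eigenvalue `λ`, which is the
maximal eigenvalue of `A`. -/
theorem exists_sparse_l1_null_vector
    (d r : ℕ) (hr : 1 ≤ r) (k : ℝ) (hk : 0 < k)
    (S : Matrix (Fin d) (Fin d) ℝ) (hS : S.PosSemidef)
    (N : Matrix (Fin d) (Fin r) ℝ)
    (hnull : ∀ j : Fin r, S.mulVec (fun i => N i j) = 0)
    (horth : ∀ j j' : Fin r, (∑ i, N i j * N i j') = if j = j' then (1 : ℝ) else 0)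
    (hspan : ∀ x : Fin d → ℝ, S.mulVec x = 0 →
      ∃ c : Fin r → ℝ, x = fun i => ∑ j, c j * N i j)
    (hrow : ∑ i, Real.sqrt (∑ j, N i j ^ 2) ≤ Real.sqrt ((r : ℝ) * k)) :
    ∃ v : Fin d → ℝ, (∑ i, v i ^ 2 = 1) ∧ S.mulVec v = 0 ∧ (∑ i, |v i| ≤ Real.sqrt k) ∧
      ∀ lam : ℝ, 0 ≤ lam →
        (lam • (1 : Matrix (Fin d) (Fin d) ℝ) - S).PosSemidef →
          (lam • (1 : Matrix (Fin d) (Fin d) ℝ) - S).mulVec v = lam • v ∧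
          ∀ μ : ℝ, Module.End.HasEigenvalue
              (Matrix.toLin' (lam • (1 : Matrix (Fin d) (Fin d) ℝ) - S)) μ → μ ≤ lam := by
  obtain ⟨ε, hε⟩ := exists_signs_sum_abs_le N
  have hr0 : (0 : ℝ) < r := by exact_mod_cast hr
  have hsr : 0 < √(r : ℝ) := Real.sqrt_pos.mpr hr0
  set c : Fin r → ℝ := fun j => ((ε j : ℤ) : ℝ) / √(r : ℝ) with hc
  have hSN : S * N = 0 := by
    ext i j
    exact congrFun (hnull j) i
  have hSv : S *ᵥ (N *ᵥ c) = 0 := by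
    rw [Matrix.mulVec_mulVec, hSN, Matrix.zero_mulVec]
  refine ⟨N *ᵥ c, ?_, hSv, ?_, fun lam _ _ => ⟨?_, fun μ hμ => eigenvalue_smul_one_sub_le hS hμ⟩⟩
  · rw [sum_sq_eq_of_orthonormal_columns N horth]
    have hcj : ∀ j, c j ^ 2 = 1 / r := by
      intro j
      rw [hc]
      simp only [div_pow, Real.sq_sqrt hr0.le]
      rcases Int.units_eq_one_or (ε j) with h | h <;> simp [h]
    simp [hcj, hr0.ne']
  · have hv : ∀ i, |(N *ᵥ c) i| = |∑ j, ((ε j : ℤ) : ℝ) * N i j| / √(r : ℝ) := by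
      intro i
      have hdiv : (N *ᵥ c) i = (∑ j, ((ε j : ℤ) : ℝ) * N i j) / √(r : ℝ) := by
        rw [Finset.sum_div, Matrix.mulVec, dotProduct]
        exact Finset.sum_congr rfl fun j _ => by simp only [hc]; ring
      rw [hdiv, abs_div, abs_of_pos hsr]
    simp only [hv]
    rw [← Finset.sum_div, div_le_iff₀ hsr, mul_comm, ← Real.sqrt_mul hr0.le]
    exact hε.trans hrow
  · rw [Matrix.sub_mulVec, hSv, Matrix.smul_mulVec, Matrix.one_mulVec, sub_zero]
end

section
/- Let A ∈ ℝ^{d×d} be symmetric and let k ≥ 1 be a real number. Suppose w* ∈ ℝ^d, μ* ∈ ℝ, λ* ∈ ℝ, and a symmetric matrix Z* ∈ ℝ^{d×d} satisfy: (primal feasibility) ‖w*‖₁ ≤ √k and ‖w*‖₂ = 1; (dual feasibility) μ* ≥ 0, |Z*_{ij}| ≤ 1 for all i,j, Z*_{ij} = sign(w*_i)·sign(w*_j) whenever w*_i·w*_j ≠ 0, and λ*·I_d − A + μ*·Z* is positive semidefinite; (complementary slackness) μ*·(‖w*‖₁ − √k) = 0 and (λ*·I_d − A + μ*·Z*)·w*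 = 0. Then W* := w*·(w*)ᵀ is an optimal solution to SPCA-SDP with input (A,k): W* is feasible and tr(AW) ≤ tr(A·W*) for every feasible W. -/
open Matrix Finset

/-- `W` is a feasible solution of the basic SDP relaxation SPCA-SDP with input `(A, k)`:
`W ⪰ 0`, `tr W = 1`, and the entrywise 1-norm of `W` is at most `k`. -/
def SDPFeasible {d : ℕ} (k : ℝ) (W : Matrix (Fin d) (Fin d) ℝ) : Prop :=
  W.PosSemidef ∧ W.trace = 1 ∧ ∑ i, ∑ j, |W i j| ≤ k

namespace Matrix.PosSemidef

variable {n : Type*} [Fintype n]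

/-- The trace of a product of two real positive semidefinite matrices is nonnegative. -/
theorem trace_mul_nonneg {M N : Matrix n n ℝ} (hM : M.PosSemidef) (hN : N.PosSemidef) :
    0 ≤ (M * N).trace := by
  obtain ⟨m, v, rfl⟩ := posSemidef_iff_eq_sum_vecMulVec.mp hN
  rw [Matrix.mul_sum, trace_sum]
  refine Finset.sum_nonneg fun i _ => ?_
  rw [mul_vecMulVec, trace_vecMulVec, dotProduct_comm]
  exact hM.dotProduct_mulVec_nonneg (v i)

end Matrix.PosSemidef

theorem Real.sign_mul_self_eq_abs (x : ℝ) : Real.sign x * x = |x| := by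
  rcases lt_trichotomy x 0 with h | rfl | h
  · rw [Real.sign_of_neg h, abs_of_neg h, neg_one_mul]
  · simp
  · rw [Real.sign_of_pos h, abs_of_pos h, one_mul]

section EntrywiseBounds

variable {n : Type*} [Fintype n]

/-- Entrywise Hölder inequality: a matrix with entries in `[-1, 1]` pairs with `W` to at most
the entrywise 1-norm of `W`. -/
theorem Matrix.trace_mul_le_sum_abs {Z : Matrix n n ℝ} (hZ : ∀ i j, |Z i j| ≤ 1)
    (W : Matrix n n ℝ) : (Z * W).trace ≤ ∑ i, ∑ j, |W i j| := by
  rw [Finset.sum_comm]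
  simp only [Matrix.trace, Matrix.diag_apply, Matrix.mul_apply]
  refine Finset.sum_le_sum fun i _ => Finset.sum_le_sum fun j _ => ?_
  calc Z i j * W j i ≤ |Z i j| * |W j i| := (le_abs_self _).trans_eq (abs_mul _ _)
    _ ≤ |W j i| := mul_le_of_le_one_left (abs_nonneg _) (hZ i j)

theorem sum_sum_abs_vecMulVec_self (w : n → ℝ) :
    ∑ i, ∑ j, |vecMulVec w w i j| = (∑ i, |w i|) ^ 2 := by
  simp only [vecMulVec_apply, abs_mul, sq, Finset.sum_mul_sum]

theorem trace_mul_vecMulVec_of_eq_sign {Z : Matrix n n ℝ} {w : n → ℝ}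
    (hZ : ∀ i j, w i * w j ≠ 0 → Z i j = Real.sign (w i) * Real.sign (w j)) :
    (Z * vecMulVec w w).trace = (∑ i, |w i|) ^ 2 := by
  simp only [Matrix.trace, Matrix.diag_apply, Matrix.mul_apply, vecMulVec_apply, sq,
    Finset.sum_mul_sum]
  refine Finset.sum_congr rfl fun i _ => Finset.sum_congr rfl fun j _ => ?_
  by_cases h : w i * w j = 0
  · rw [mul_comm (w j), h, mul_zero, ← abs_mul, h, abs_zero]
  · rw [hZ i j h, ← Real.sign_mul_self_eq_abs, ← Real.sign_mul_self_eq_abs]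
    ring

end EntrywiseBounds

/-- KKT-type sufficient conditions for `w* (w*)ᵀ` to be an optimal
solution of SPCA-SDP with input `(A, k)`. -/
theorem KKT_sufficient_for_SDP_optimality
    (d : ℕ) (A : Matrix (Fin d) (Fin d) ℝ) (hA : A.IsSymm)
    (k : ℝ) (hk : 1 ≤ k)
    (w : Fin d → ℝ) (mu lam : ℝ) (Z : Matrix (Fin d) (Fin d) ℝ) (hZsymm : Z.IsSymm)
    -- primal feasibility
    (hw1 : ∑ i, |w i| ≤ Real.sqrt k)
    (hw2 : ∑ i, w i ^ 2 = 1)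
    -- dual feasibility
    (hmu : 0 ≤ mu)
    (hZbound : ∀ i j, |Z i j| ≤ 1)
    (hZsign : ∀ i j, w i * w j ≠ 0 → Z i j = Real.sign (w i) * Real.sign (w j))
    (hpsd : (lam • (1 : Matrix (Fin d) (Fin d) ℝ) - A + mu • Z).PosSemidef)
    -- complementary slackness
    (hcs1 : mu * ((∑ i, |w i|) - Real.sqrt k) = 0)
    (hcs2 : (lam • (1 : Matrix (Fin d) (Fin d) ℝ) - A + mu • Z).mulVec w = 0) :
    SDPFeasible k (vecMulVec w w) ∧
      ∀ W : Matrix (Fin d) (Fin d) ℝ, SDPFeasible k W →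
        (A * W).trace ≤ (A * vecMulVec w w).trace := by
  have hk0 : 0 ≤ k := zero_le_one.trans hk
  have htr : (vecMulVec w w).trace = 1 := by
    rw [trace_vecMulVec, ← hw2]
    simp only [dotProduct, sq]
  have hdecomp : ∀ W : Matrix (Fin d) (Fin d) ℝ,
      ((lam • (1 : Matrix (Fin d) (Fin d) ℝ) - A + mu • Z) * W).trace =
        lam * W.trace - (A * W).trace + mu * (Z * W).trace := fun W => by
    simp [add_mul, sub_mul, trace_add, trace_sub]
  refine ⟨⟨posSemidef_vecMulVec_self_star w, htr, ?_⟩, fun W ⟨hW, hWtr, hWk⟩ => ?_⟩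
  · rw [sum_sum_abs_vecMulVec_self]
    exact (Real.le_sqrt (Finset.sum_nonneg fun i _ => abs_nonneg (w i)) hk0).mp hw1
  · have hslack : mu * (∑ i, |w i|) ^ 2 = mu * k := by
      linear_combination ((∑ i, |w i|) + √k) * hcs1 + mu * Real.sq_sqrt hk0
    have hopt := hdecomp (vecMulVec w w)
    rw [mul_vecMulVec, hcs2, zero_vecMulVec, trace_zero, htr,
      trace_mul_vecMulVec_of_eq_sign hZsign, hslack] at hopt
    have hdual := hpsd.trace_mul_nonneg hW
    rw [hdecomp, hWtr] at hdual
    have hZW : mu * (Z * W).trace ≤ mu * k :=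
      mul_le_mul_of_nonneg_left ((trace_mul_le_sum_abs hZbound W).trans hWk) hmu
    linarith
end

section
/- Let n, d be positive integers, k ≥ 1, and a ≥ 0. Let B ∈ ℝ^{n×d} and E ∈ ℝ^{d×d} with max_{i,j} |E_{ij}| ≤ a, and set A = BᵀB + E. Let λ₁ and λ₂ be the largest and second largest eigenvalues of BᵀB, assume λ₁ − λ₂ > 0, and assume BᵀB has a unit eigenvector v associated with λ₁ that has at most k nonzero entries. If W* is an optimal solution to SPCA-SDP with input (A,k), then ‖W* − v·vᵀ‖_F ≤ 2ak/(λ₁−λ₂) + √(2ak/(λ₁−λ₂)). -/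
open Matrix Finset

/-- The entries of a real positive semidefinite matrix satisfy the Cauchy–Schwarz inequality. -/
lemma Matrix.PosSemidef.apply_sq_le {ι : Type*} [Fintype ι] {W : Matrix ι ι ℝ}
    (hW : W.PosSemidef) (i j : ι) : W i j ^ 2 ≤ W i i * W j j := by
  have h := (hW.submatrix ![i, j]).det_nonneg
  have hs : W j i = W i j := by simpa using hW.isHermitian.apply i j
  simp only [det_fin_two, submatrix_apply, cons_val_zero, cons_val_one, hs] at h
  linarith

/-- The Frobenius norm of a positive semidefinite matrix is at most its trace. -/
lemma Matrix.PosSemidef.sum_sq_le_trace_sq {ι : Type*} [Fintype ι] {W : Matrix ι ι ℝ}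
    (hW : W.PosSemidef) : ∑ i, ∑ j, W i j ^ 2 ≤ W.trace ^ 2 := by
  rw [sq W.trace, Matrix.trace, Finset.sum_mul_sum]
  exact sum_le_sum fun i _ => sum_le_sum fun j _ => hW.apply_sq_le i j

/-- If `v` is a unit eigenvector for an eigenvalue `μ j₀` of a symmetric matrix `G` whose other
eigenvalues are at most `m < μ j₀`, then `tr (G W) ≤ μ j₀ p + m (tr W - p)` with `p = vᵀ W v`
for every positive semidefinite `W`. -/
lemma Matrix.IsHermitian.trace_mul_le {ι : Type*} [Fintype ι] [DecidableEq ι]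
    {G W : Matrix ι ι ℝ} (hG : G.IsHermitian) (hW : W.PosSemidef) {j₀ : ι} {m : ℝ}
    (hm : m < hG.eigenvalues j₀) (hle : ∀ j ≠ j₀, hG.eigenvalues j ≤ m)
    {v : ι → ℝ} (hv : v ⬝ᵥ v = 1) (hGv : G *ᵥ v = hG.eigenvalues j₀ • v) :
    (G * W).trace ≤ hG.eigenvalues j₀ * (v ⬝ᵥ W *ᵥ v) + m * (W.trace - v ⬝ᵥ W *ᵥ v) := by
  set μ := hG.eigenvalues with hμ
  obtain ⟨U, hUU, hUU', hspec⟩ : ∃ U : Matrix ι ι ℝ, Uᵀ * U = 1 ∧ U * Uᵀ = 1 ∧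
      G = U * diagonal μ * Uᵀ := by
    refine ⟨hG.eigenvectorUnitary, ?_, ?_, ?_⟩
    · simpa [star_eq_conjTranspose] using Unitary.coe_star_mul_self hG.eigenvectorUnitary
    · simpa [star_eq_conjTranspose] using Unitary.coe_mul_star_self hG.eigenvectorUnitary
    · simpa [Unitary.conjStarAlgAut_apply, star_eq_conjTranspose] using hG.spectral_theorem
  set Q := Uᵀ * W * U with hQ
  have hQpos : Q.PosSemidef := by simpa [hQ] using hW.conjTranspose_mul_mul_same U
  have hWQ : W = U * Q * Uᵀ := by
    calc W = (U * Uᵀ) * W * (U * Uᵀ) := by simp [hUU']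
      _ = _ := by simp only [hQ, Matrix.mul_assoc]
  have htrW : W.trace = ∑ j, Q j j := by
    rw [hWQ, trace_mul_cycle, hUU, Matrix.one_mul]; rfl
  have htrGW : (G * W).trace = ∑ j, μ j * Q j j := by
    have : G * W = U * (diagonal μ * Uᵀ * W) := by rw [hspec]; simp only [Matrix.mul_assoc]
    rw [this, trace_mul_comm, Matrix.mul_assoc, Matrix.mul_assoc, ← Matrix.mul_assoc Uᵀ]
    simp [Matrix.trace, diagonal_mul, ← hQ]
  set y := Uᵀ *ᵥ v with hy
  have hvy : v = U *ᵥ y := by simp [hy, mulVec_mulVec, hUU']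
  have hDy : diagonal μ *ᵥ y = μ j₀ • y := by
    have h := congrArg (fun z => Uᵀ *ᵥ z) hGv
    simp only [mulVec_smul, mulVec_mulVec, hspec] at h
    rw [← hy, Matrix.mul_assoc U, ← Matrix.mul_assoc Uᵀ, hUU, Matrix.one_mul, ← mulVec_mulVec] at h
    exact h
  have hy0 : ∀ j ≠ j₀, y j = 0 := by
    intro j hj
    have h := congrFun hDy j
    simp only [mulVec_diagonal, Pi.smul_apply, smul_eq_mul] at h
    have hlt : μ j < μ j₀ := (hle j hj).trans_lt hm
    have : (μ j₀ - μ j) * y j = 0 := by linarith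
    exact (mul_eq_zero.mp this).resolve_left (by linarith)
  have hyy : y j₀ ^ 2 = 1 := by
    have h : y ⬝ᵥ y = 1 := by
      rw [hy, dotProduct_mulVec, ← mulVec_transpose, transpose_transpose, mulVec_mulVec, hUU',
        one_mulVec, hv]
    rw [dotProduct, sum_eq_single j₀ (fun j _ hj => by simp [hy0 j hj]) (by simp)] at h
    rw [sq, h]
  have hp : v ⬝ᵥ W *ᵥ v = Q j₀ j₀ := by
    have h : v ⬝ᵥ W *ᵥ v = y ⬝ᵥ Q *ᵥ y := by
      rw [hQ, ← mulVec_mulVec, ← mulVec_mulVec, ← hvy, dotProduct_mulVec y, ← mulVec_transpose,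
        transpose_transpose, ← hvy]
    have hQy : (Q *ᵥ y) j₀ = Q j₀ j₀ * y j₀ :=
      sum_eq_single j₀ (fun j _ hj => by simp [hy0 j hj]) (by simp)
    rw [h, dotProduct, sum_eq_single j₀ (fun j _ hj => by simp [hy0 j hj]) (by simp), hQy]
    linear_combination Q j₀ j₀ * hyy
  rw [hp, htrW, htrGW, ← add_sum_erase _ _ (mem_univ j₀), ← add_sum_erase _ (fun j => Q j j)
    (mem_univ j₀), add_sub_cancel_left, mul_sum]
  gcongr with j hj
  · exact hQpos.diag_nonneg
  · exact hle j (ne_of_mem_erase hj)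

/-- A `k`-sparse unit vector `v` gives a feasible solution `v vᵀ` of SPCA-SDP. -/
lemma SDPFeasible.vecMulVec {d : ℕ} {k : ℝ} {v : Fin d → ℝ} (hunit : ∑ i, v i ^ 2 = 1)
    (hsparse : (Set.ncard {i : Fin d | v i ≠ 0} : ℝ) ≤ k) :
    SDPFeasible k (vecMulVec v v) := by
  refine ⟨by simpa using posSemidef_vecMulVec_self_star v, ?_, ?_⟩
  · simpa [Matrix.trace, vecMulVec_apply, sq] using hunit
  · have hcard : (#{i : Fin d | v i ≠ 0} : ℝ) ≤ k := by
      rwa [Set.ncard_eq_toFinset_card', Set.toFinset_ofFinset] at hsparse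
    calc ∑ i, ∑ j, |Matrix.vecMulVec v v i j| = (∑ i, |v i|) ^ 2 := by
          simp [vecMulVec_apply, abs_mul, sq, sum_mul_sum]
      _ = (∑ i with v i ≠ 0, |v i|) ^ 2 := by
          rw [sum_filter_of_ne fun i _ h => by simpa using h]
      _ ≤ #{i : Fin d | v i ≠ 0} * ∑ i with v i ≠ 0, |v i| ^ 2 := sq_sum_le_card_mul_sum_sq
      _ = #{i : Fin d | v i ≠ 0} := by
          rw [sum_filter_of_ne fun i _ h => by simpa using h]
          simp [hunit]
      _ ≤ k := hcard

/-- If `v` is `k`-sparse then `‖W - v vᵀ‖₁ ≤ ‖W‖₁ + k ‖W - v vᵀ‖_F`. -/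
lemma sum_abs_sub_le_of_sparse {d : ℕ} {k : ℝ} {v : Fin d → ℝ}
    (hsparse : (Set.ncard {i : Fin d | v i ≠ 0} : ℝ) ≤ k) (W : Matrix (Fin d) (Fin d) ℝ) :
    ∑ i, ∑ j, |W i j - v i * v j| ≤
      ∑ i, ∑ j, |W i j| + k * √(∑ i, ∑ j, (W i j - v i * v j) ^ 2) := by
  set S : Finset (Fin d) := {i | v i ≠ 0} with hS
  have hcard : (#S : ℝ) ≤ k := by
    rwa [Set.ncard_eq_toFinset_card', Set.toFinset_ofFinset] at hsparse
  have hk : 0 ≤ k := (Nat.cast_nonneg _).trans hcard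
  simp only [← sum_product', univ_product_univ]
  have hsupp : ∑ p ∈ S ×ˢ S, |W p.1 p.2 - v p.1 * v p.2| ≤
      k * √(∑ p : Fin d × Fin d, (W p.1 p.2 - v p.1 * v p.2) ^ 2) := by
    refine le_of_sq_le_sq ?_ (by positivity)
    calc _ ≤ (#(S ×ˢ S) : ℝ) * ∑ p ∈ S ×ˢ S, |W p.1 p.2 - v p.1 * v p.2| ^ 2 :=
          sq_sum_le_card_mul_sum_sq
      _ ≤ k ^ 2 * ∑ p : Fin d × Fin d, (W p.1 p.2 - v p.1 * v p.2) ^ 2 := by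
          simp only [sq_abs]
          gcongr
          · rw [card_product, Nat.cast_mul, ← sq]
            gcongr
          · exact subset_univ _
      _ = _ := by rw [mul_pow, Real.sq_sqrt (by positivity)]
  calc ∑ p : Fin d × Fin d, |W p.1 p.2 - v p.1 * v p.2|
      ≤ ∑ p : Fin d × Fin d, (|W p.1 p.2| +
          if p ∈ S ×ˢ S then |W p.1 p.2 - v p.1 * v p.2| else 0) := by
        refine sum_le_sum fun p _ => ?_
        split_ifs with h
        · linarith [abs_nonneg (W p.1 p.2)]
        · have : v p.1 * v p.2 = 0 := by
            by_contra hne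
            exact h (by simpa [hS] using hne)
          simp [this]
    _ = ∑ p : Fin d × Fin d, |W p.1 p.2| + ∑ p ∈ S ×ˢ S, |W p.1 p.2 - v p.1 * v p.2| := by
        rw [sum_add_distrib, sum_ite_mem, univ_inter]
    _ ≤ _ := by gcongr

/-- Let `A = Bᵀ B + E` with `‖E‖_∞ ≤ a`, let `lam i0 > lam i1` be the
largest and second largest eigenvalues of `Bᵀ B` (the eigenvalues of `Bᵀ B` listed in
nonincreasing order), and let `v` be a `k`-sparse unit eigenvector of `Bᵀ B` for the
largest eigenvalue. If `W` is an optimal solution to SPCA-SDP with input `(A, k)` then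
`‖W − v vᵀ‖_F ≤ 2ak/(λ₁−λ₂) + √(2ak/(λ₁−λ₂))`. -/
theorem SDP_opt_close_to_spike_deterministic
    (n d : ℕ) (hd : 2 ≤ d) (k a : ℝ) (hk : 1 ≤ k) (ha : 0 ≤ a)
    (B : Matrix (Fin n) (Fin d) ℝ) (E : Matrix (Fin d) (Fin d) ℝ)
    (hE : ∀ i j, |E i j| ≤ a)
    (A : Matrix (Fin d) (Fin d) ℝ) (hAdef : A = Bᵀ * B + E)
    (hherm : (Bᵀ * B).IsHermitian)
    (lam : Fin d → ℝ) (hanti : Antitone lam)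
    (hperm : ∃ σ : Equiv.Perm (Fin d), lam = hherm.eigenvalues ∘ σ)
    (i0 i1 : Fin d) (hi0 : (i0 : ℕ) = 0) (hi1 : (i1 : ℕ) = 1)
    (hgap : lam i1 < lam i0)
    (v : Fin d → ℝ) (hunit : ∑ i, v i ^ 2 = 1)
    (hsparse : (Set.ncard {i : Fin d | v i ≠ 0} : ℝ) ≤ k)
    (heig : (Bᵀ * B).mulVec v = lam i0 • v)
    (W : Matrix (Fin d) (Fin d) ℝ) (hfeas : SDPFeasible k W)
    (hopt : ∀ W' : Matrix (Fin d) (Fin d) ℝ, SDPFeasible k W' →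
      (A * W').trace ≤ (A * W).trace) :
    Real.sqrt (∑ i, ∑ j, (W i j - v i * v j) ^ 2) ≤
      2 * a * k / (lam i0 - lam i1) + Real.sqrt (2 * a * k / (lam i0 - lam i1)) := by
  obtain ⟨σ, rfl⟩ := hperm
  obtain ⟨hWpos, hWtr, hWl1⟩ := hfeas
  set G := Bᵀ * B with hG
  set x := √(∑ i, ∑ j, (W i j - v i * v j) ^ 2) with hx
  set gap := (hherm.eigenvalues ∘ σ) i0 - (hherm.eigenvalues ∘ σ) i1 with hgapdef
  have hgap_pos : 0 < gap := sub_pos.mpr hgap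
  set p := v ⬝ᵥ W *ᵥ v with hp
  have hp_sum : p = ∑ i, ∑ j, W i j * (v i * v j) := by
    simp only [hp, dotProduct, mulVec, mul_sum]
    exact sum_congr rfl fun i _ => sum_congr rfl fun j _ => by ring
  have hvv : v ⬝ᵥ v = 1 := by simpa [dotProduct, sq] using hunit
  have hspec : (G * W).trace ≤ (hherm.eigenvalues ∘ σ) i0 * p +
      (hherm.eigenvalues ∘ σ) i1 * (1 - p) := by
    rw [← hWtr]
    refine hherm.trace_mul_le hWpos hgap (fun j hj => ?_) hvv heig
    have hne : σ.symm j ≠ i0 := fun h => hj (by simp [← h])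
    have hle : i1 ≤ σ.symm j := by
      rw [Fin.le_def, hi1]
      have : ((σ.symm j : Fin d) : ℕ) ≠ i0 := fun h => hne (Fin.ext h)
      omega
    simpa using hanti hle
  have hspike : (G * vecMulVec v v).trace = (hherm.eigenvalues ∘ σ) i0 := by
    rw [mul_vecMulVec, heig, trace_vecMulVec, smul_dotProduct, hvv, smul_eq_mul, mul_one]
  have hnoise : (E * W).trace - (E * vecMulVec v v).trace ≤ a * (k + k * x) := by
    have hsum : ∑ i, ∑ j, |W i j - v i * v j| ≤ k + k * x :=
      (sum_abs_sub_le_of_sparse hsparse W).trans (by gcongr)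
    refine le_trans ?_ (mul_le_mul_of_nonneg_left hsum ha)
    rw [← trace_sub, ← Matrix.mul_sub, trace_mul_comm]
    simp only [Matrix.trace, diag_apply, mul_apply, mul_sum, Matrix.sub_apply, vecMulVec_apply]
    refine sum_le_sum fun i _ => sum_le_sum fun j _ => (le_abs_self _).trans ?_
    rw [abs_mul, mul_comm]
    gcongr
    exact hE j i
  have hcomp := hopt _ (SDPFeasible.vecMulVec hunit hsparse)
  rw [hAdef, Matrix.add_mul, Matrix.add_mul, trace_add, trace_add, hspike] at hcomp
  have hdeficit : gap * (1 - p) ≤ a * (k + k * x) := by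
    rw [hgapdef]
    linarith
  have hx0 : 0 ≤ x := Real.sqrt_nonneg _
  have hxsq : x ^ 2 ≤ 2 * (1 - p) := by
    have hexp : x ^ 2 = ∑ i, ∑ j, W i j ^ 2 - 2 * p + (∑ i, v i ^ 2) * ∑ j, v j ^ 2 := by
      rw [hx, Real.sq_sqrt (by positivity), hp_sum, sum_mul_sum]
      simp only [mul_sum, ← sum_sub_distrib, ← sum_add_distrib]
      exact sum_congr rfl fun i _ => sum_congr rfl fun j _ => by ring
    have hF := hWpos.sum_sq_le_trace_sq
    rw [hWtr] at hF
    rw [hexp, hunit]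
    linarith
  set δ := 2 * a * k / gap with hδ
  have hδ0 : 0 ≤ δ := by positivity
  have hquad : x ^ 2 ≤ δ * (1 + x) := by
    have h : gap * δ = 2 * a * k := by rw [hδ]; field_simp
    refine le_of_mul_le_mul_left ?_ hgap_pos
    calc gap * x ^ 2 ≤ gap * (2 * (1 - p)) := by gcongr
      _ ≤ 2 * a * k * (1 + x) := by linarith
      _ = gap * (δ * (1 + x)) := by rw [← h]; ring
  rcases le_total x δ with hle | hle
  · linarith [Real.sqrt_nonneg δ]
  · have : x - δ ≤ √δ := Real.le_sqrt_of_sq_le (by nlinarith)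
    linarith
end

section
/- Let A ∈ ℝ^{d×d} be symmetric positive semidefinite and let k be an integer with 1 ≤ k ≤ d. Then there exists a subset S ⊆ {1,…,d} with |S| = k such that the largest eigenvalue of the principal submatrix A_{S,S} satisfies λ_max(A_{S,S}) ≥ (k/d) · λ_max(A). Equivalently, the maximum of xᵀAx over unit vectors x ∈ ℝ^d with at most k nonzero entries is at least (k/d) times the largest eigenvalue of A. -/
open Matrix Finset

/-- Some `k`-subset of a finite type has average at least the overall average. -/
theorem exists_card_eq_mul_sum_le {ι : Type*} [Fintype ι] [DecidableEq ι] (f : ι → ℝ) {k : ℕ}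
    (hk : k ≤ Fintype.card ι) :
    ∃ S : Finset ι, S.card = k ∧ (k : ℝ) * ∑ i, f i ≤ Fintype.card ι * ∑ i ∈ S, f i := by
  induction hk using Nat.decreasingInduction with
  | self => exact ⟨Finset.univ, Finset.card_univ, le_rfl⟩
  | of_succ k _ ih =>
    obtain ⟨S, hS, hle⟩ := ih
    have hne : S.Nonempty := Finset.card_pos.mp (by omega)
    obtain ⟨a, ha, hmin⟩ := S.exists_min_image f hne
    refine ⟨S.erase a, by rw [Finset.card_erase_of_mem ha, hS]; rfl, ?_⟩
    have hmul : ((k : ℝ) + 1) * f a ≤ ∑ i ∈ S, f i := by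
      have h := Finset.card_nsmul_le_sum S f (f a) hmin
      rwa [hS, nsmul_eq_mul, Nat.cast_succ] at h
    have hsum := eq_sub_of_add_eq' (Finset.add_sum_erase S f ha)
    have hcard : (0 : ℝ) ≤ Fintype.card ι := Nat.cast_nonneg _
    push_cast at hle
    have hk0 : (0 : ℝ) ≤ k := Nat.cast_nonneg _
    have hkey : (k : ℝ) * ∑ i ∈ S, f i ≤ (k + 1) * ∑ i ∈ S.erase a, f i := by
      rw [hsum]
      linarith
    have h1 := mul_le_mul_of_nonneg_left hkey hcard
    have h2 := mul_le_mul_of_nonneg_left hle hk0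
    refine le_of_mul_le_mul_left ?_ (show (0 : ℝ) < k + 1 by positivity)
    linarith

/-- A maximizer of the Rayleigh quotient of a symmetric matrix is an eigenvector. -/
theorem mulVec_eq_smul_of_rayleigh_eq {n : Type*} [Fintype n] [DecidableEq n]
    {A : Matrix n n ℝ} (hA : A.IsHermitian) {l : ℝ}
    (hub : ∀ x : n → ℝ, x ⬝ᵥ A *ᵥ x ≤ l * (x ⬝ᵥ x)) {x : n → ℝ}
    (hx : x ⬝ᵥ A *ᵥ x = l * (x ⬝ᵥ x)) : A *ᵥ x = l • x := by
  have hform (z : n → ℝ) :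
      z ⬝ᵥ (l • (1 : Matrix n n ℝ) - A) *ᵥ z = l * (z ⬝ᵥ z) - z ⬝ᵥ A *ᵥ z := by
    simp [Matrix.sub_mulVec, Matrix.smul_mulVec, dotProduct_sub, dotProduct_smul]
  have hpsd : (l • (1 : Matrix n n ℝ) - A).PosSemidef := by
    refine Matrix.PosSemidef.of_dotProduct_mulVec_nonneg ?_ fun z => ?_
    · exact (Matrix.isHermitian_one.smul (IsSelfAdjoint.all l)).sub hA
    · rw [star_trivial, hform]
      exact sub_nonneg.mpr (hub z)
  have h := (hpsd.dotProduct_mulVec_zero_iff x).mp (by rw [star_trivial, hform, hx, sub_self])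
  rw [Matrix.sub_mulVec, Matrix.smul_mulVec, Matrix.one_mulVec, sub_eq_zero] at h
  exact h.symm

/-- A positive semidefinite matrix dominates the rank one part `l x xᵀ` of a unit eigenvector. -/
theorem Matrix.PosSemidef.mul_sq_dotProduct_le {n : Type*} [Fintype n]
    {A : Matrix n n ℝ} (hA : A.PosSemidef) {l : ℝ} {x : n → ℝ} (hx : x ⬝ᵥ x = 1)
    (heig : A *ᵥ x = l • x) (y : n → ℝ) : l * (x ⬝ᵥ y) ^ 2 ≤ y ⬝ᵥ A *ᵥ y := by
  have h := hA.dotProduct_mulVec_nonneg (y - (x ⬝ᵥ y) • x)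
  have hsymm : x ⬝ᵥ A *ᵥ y = l * (x ⬝ᵥ y) := by
    have hT : Aᵀ = A := by simpa using hA.isHermitian.eq
    rw [Matrix.dotProduct_mulVec, ← Matrix.mulVec_transpose, hT, heig, smul_dotProduct,
      smul_eq_mul]
  rw [star_trivial, Matrix.mulVec_sub, Matrix.mulVec_smul, heig] at h
  simp only [sub_dotProduct, dotProduct_sub, smul_dotProduct, dotProduct_smul, smul_eq_mul,
    hsymm, hx, dotProduct_comm y x] at h
  linarith

/-- For `A ⪰ 0` of size `d` and `1 ≤ k ≤ d`, there is a subset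
`S ⊆ {1,…,d}` with `|S| = k` such that the largest eigenvalue of the principal submatrix
`A_{S,S}` is at least `(k/d)·λ_max(A)`; equivalently, there is a unit vector `y` supported
on `S` (hence with at most `k` nonzero entries) whose Rayleigh quotient is at least
`(k/d)·λ_max(A)`.  Here `lamA` denotes the largest eigenvalue of `A`, characterized by
`xᵀAx ≤ lamA·‖x‖²` for all `x`, with equality attained by some unit vector. -/
theorem exists_principal_submatrix_large_eigenvalue
    (d k : ℕ) (hk1 : 1 ≤ k) (hkd : k ≤ d)
    (A : Matrix (Fin d) (Fin d) ℝ) (hA : A.PosSemidef)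
    (lamA : ℝ)
    (hub : ∀ x : Fin d → ℝ, x ⬝ᵥ A.mulVec x ≤ lamA * (x ⬝ᵥ x))
    (hatt : ∃ x : Fin d → ℝ, (∑ i, x i ^ 2 = 1) ∧ x ⬝ᵥ A.mulVec x = lamA) :
    ∃ S : Finset (Fin d), S.card = k ∧
      ∃ y : Fin d → ℝ, (∀ i, y i ≠ 0 → i ∈ S) ∧ (∑ i, y i ^ 2 = 1) ∧
        ((k : ℝ) / (d : ℝ)) * lamA ≤ y ⬝ᵥ A.mulVec y := by
  obtain ⟨x, hx1, hxl⟩ := hatt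
  have hxx : x ⬝ᵥ x = 1 := by simpa [dotProduct, sq] using hx1
  have heig := mulVec_eq_smul_of_rayleigh_eq hA.isHermitian hub
    (by rw [hxl, hxx, mul_one] : x ⬝ᵥ A *ᵥ x = lamA * (x ⬝ᵥ x))
  have hl : 0 ≤ lamA := hxl ▸ hA.dotProduct_mulVec_nonneg x
  obtain ⟨S, hS, hle⟩ := exists_card_eq_mul_sum_le (fun i => x i ^ 2)
    (by simpa using hkd : k ≤ Fintype.card (Fin d))
  rw [hx1, mul_one, Fintype.card_fin] at hle
  have hd : (0 : ℝ) < d := by exact_mod_cast hk1.trans hkd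
  have hk : (0 : ℝ) < k := by exact_mod_cast hk1
  set s := ∑ i ∈ S, x i ^ 2 with hs
  have hks : (k : ℝ) / d ≤ s := by rwa [div_le_iff₀' hd]
  have hspos : 0 < s := (div_pos hk hd).trans_le hks
  have hsq : √s ^ 2 = s := Real.sq_sqrt hspos.le
  refine ⟨S, hS, fun i => if i ∈ S then x i / √s else 0, fun i hi => ?_, ?_, ?_⟩
  · by_contra hiS
    simp [hiS] at hi
  · simp only [ite_pow, div_pow, hsq, ne_eq, OfNat.ofNat_ne_zero, not_false_eq_true, zero_pow,
      Finset.sum_ite_mem, Finset.univ_inter]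
    rw [← Finset.sum_div, ← hs, div_self hspos.ne']
  · refine le_trans ?_ (hA.mul_sq_dotProduct_le hxx heig _)
    have hdot : (x ⬝ᵥ fun i => if i ∈ S then x i / √s else 0) = s / √s := by
      simp only [dotProduct, mul_ite, mul_zero, Finset.sum_ite_mem, Finset.univ_inter]
      rw [hs, Finset.sum_div]
      exact Finset.sum_congr rfl fun i _ => by ring
    rw [hdot, Real.div_sqrt, hsq, mul_comm]
    exact mul_le_mul_of_nonneg_left hks hl
end

section
/- Let v ∈ ℝ^d be a unit vector with support S = {i : v_i ≠ 0} satisfying |S| ≤ k for a positive integer k, and let W be a feasible solution to SPCA-SDP with input (A,k) for some symmetric A (i.e., W ⪰ 0, tr(W) = 1, ∑_{i,j}|W_{ij}| ≤ k). Then ∑_{i,j=1}^d |(v·vᵀ − W)_{ij}| ≤ k·‖(v·vᵀ − W)_{S,S}‖_F + k, where (v·vᵀ − W)_{S,S} is the principal submatrix indexed by S. -/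
open Matrix Finset

/-- By Cauchy-Schwarz, the entrywise `1`-norm of an `S × S` block is at most `|S|` times its
Frobenius norm. -/
theorem sum_abs_le_card_mul_sqrt_sum_sq {ι : Type*} (S : Finset ι) (M : ι → ι → ℝ) :
    ∑ i ∈ S, ∑ j ∈ S, |M i j| ≤ (S.card : ℝ) * Real.sqrt (∑ i ∈ S, ∑ j ∈ S, M i j ^ 2) := by
  rw [← Finset.sum_product', ← Finset.sum_product']
  have h := sq_sum_le_card_mul_sum_sq (s := S ×ˢ S) (f := fun p => |M p.1 p.2|)
  simp only [sq_abs, Finset.card_product, Nat.cast_mul] at h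
  refine (Real.le_sqrt_of_sq_le h).trans_eq ?_
  rw [Real.sqrt_mul (by positivity), Real.sqrt_mul_self (by positivity)]

/-- Let `v` be a unit vector with support `S` of size at most `k`, and
let `W` be feasible for SPCA-SDP with input `(A, k)` (for some symmetric `A`). Then
`∑_{i,j} |(v vᵀ − W) i j| ≤ k·‖(v vᵀ − W)_{S,S}‖_F + k`. -/
theorem entrywise_l1_le_k_frobenius_submatrix_add_k
    (d k : ℕ) (hk : 0 < k)
    (v : Fin d → ℝ) (hunit : ∑ i, v i ^ 2 = 1)
    (S : Finset (Fin d)) (hS : ∀ i, i ∈ S ↔ v i ≠ 0) (hcard : S.card ≤ k)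
    (A : Matrix (Fin d) (Fin d) ℝ) (hA : A.IsSymm)
    (W : Matrix (Fin d) (Fin d) ℝ) (hW : SDPFeasible (k : ℝ) W) :
    ∑ i, ∑ j, |v i * v j - W i j| ≤
      (k : ℝ) * Real.sqrt (∑ i ∈ S, ∑ j ∈ S, (v i * v j - W i j) ^ 2) + k := by
  have hpoint (i j : Fin d) : |v i * v j - W i j| ≤
      (if i ∈ S then if j ∈ S then |v i * v j - W i j| else 0 else 0) + |W i j| := by
    split_ifs with hi hj
    · linarith [abs_nonneg (W i j)]
    · have hj0 : v j = 0 := by simpa [hS] using hj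
      simp [hj0]
    · have hi0 : v i = 0 := by simpa [hS] using hi
      simp [hi0]
  calc ∑ i, ∑ j, |v i * v j - W i j|
      ≤ ∑ i, ∑ j, ((if i ∈ S then if j ∈ S then |v i * v j - W i j| else 0 else 0) + |W i j|) :=
        Finset.sum_le_sum fun i _ => Finset.sum_le_sum fun j _ => hpoint i j
    _ = ∑ i ∈ S, ∑ j ∈ S, |v i * v j - W i j| + ∑ i, ∑ j, |W i j| := by
        simp only [Finset.sum_add_distrib, Finset.sum_ite_irrel, Finset.sum_const_zero,
          Finset.sum_ite_mem, Finset.univ_inter]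
    _ ≤ (k : ℝ) * Real.sqrt (∑ i ∈ S, ∑ j ∈ S, (v i * v j - W i j) ^ 2) + k := by
        refine add_le_add ((sum_abs_le_card_mul_sqrt_sum_sq S _).trans ?_) hW.2.2
        gcongr
end
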